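/- The transformation D_L preserves well orders if and only if L is ill-founded: for a linear order L on ℕ, D_L(α) is well-founded for every well order α exactly when L contains an infinite strictly descending sequence. -/

import Mathlib

/-- Finite sequences that are strictly increasing with respect to the relation `lt`. -/
def IncList {α : Type*} (lt : α → α → Prop) : Type _ := {l : List α // l.Chain' lt}

/-- `π` is the family of permutations determined by the linear order `Lle` on `ℕ`:
`π n i ≤ π n j` (in `ℕ`) iff `i ≤_L j`. -/
def PermOf (Lle : ℕ → ℕ → Prop) (π : ∀ n, Equiv.Perm (Fin n)) : Prop :=
  ∀ n, ∀ i j : Fin n, (((π n i : ℕ) ≤ (π n j : ℕ)) ↔ Lle (i : ℕ) (j : ℕ))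

/-- The permuted lexicographic strict order on `D_L(α)` determined by the
permutations `π`:  `σ < τ` iff either the permuted readings first differ at a
position where `σ`'s entry is `lt`-smaller, or the reading of `σ` is a proper
initial segment of that of `τ`. -/
def DLt {α : Type*} (lt : α → α → Prop) (π : ∀ n, Equiv.Perm (Fin n))
    (σ τ : IncList lt) : Prop :=
  (∃ j : ℕ, ∃ hs : j < σ.1.length, ∃ ht : j < τ.1.length,
      lt (σ.1.get (π σ.1.length ⟨j, hs⟩)) (τ.1.get (π τ.1.length ⟨j, ht⟩)) ∧
      ∀ i : ℕ, ∀ his : i < σ.1.length, ∀ hit : i < τ.1.length, i < j →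
        σ.1.get (π σ.1.length ⟨i, his⟩) = τ.1.get (π τ.1.length ⟨i, hit⟩))
  ∨ (σ.1.length < τ.1.length ∧
      ∀ i : ℕ, ∀ his : i < σ.1.length, ∀ hit : i < τ.1.length,
        σ.1.get (π σ.1.length ⟨i, his⟩) = τ.1.get (π τ.1.length ⟨i, hit⟩))

namespace DLaux

/-- The `i`-th entry of the permuted reading. -/
def rd {α : Type} {lt : α → α → Prop} (π : ∀ n, Equiv.Perm (Fin n)) (σ : IncList lt) (i : ℕ)
    (h : i < σ.1.length) : α := σ.1.get (π σ.1.length ⟨i, h⟩)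

theorem perm_cast (π : ∀ n, Equiv.Perm (Fin n)) {m n : ℕ} (e : m = n) (i : ℕ) (h : i < m)
    (h' : i < n) : (π m ⟨i, h⟩ : ℕ) = (π n ⟨i, h'⟩ : ℕ) := by
  subst e; rfl

theorem rd_lt {α : Type} {lt : α → α → Prop} (hlt : IsStrictTotalOrder α lt)
    {Lle : ℕ → ℕ → Prop} {π : ∀ n, Equiv.Perm (Fin n)} (hπ : PermOf Lle π) (σ : IncList lt)
    (i j : ℕ) (hi : i < σ.1.length) (hj : j < σ.1.length) (hij : Lle i j) (hne : i ≠ j) :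
    lt (rd π σ i hi) (rd π σ j hj) := by
  have hp : σ.1.Pairwise lt := List.isChain_iff_pairwise.1 σ.2
  have h1 := (hπ _ ⟨i, hi⟩ ⟨j, hj⟩).2 hij
  have h2 : π _ ⟨i, hi⟩ ≠ π _ ⟨j, hj⟩ := by
    intro h
    have := (π _).injective h
    simp at this
    exact hne this
  exact List.pairwise_iff_get.1 hp _ _ (lt_of_le_of_ne h1 h2)

theorem exists_inc {α : Type} {lt : α → α → Prop} (hlt : IsStrictTotalOrder α lt)
    {Lle : ℕ → ℕ → Prop} {π : ∀ n, Equiv.Perm (Fin n)} (hπ : PermOf Lle π) (n : ℕ)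
    (v : ℕ → α) (hv : ∀ i j, i < n → j < n → Lle i j → i ≠ j → lt (v i) (v j)) :
    ∃ σ : IncList lt, σ.1.length = n ∧ ∀ i h, rd π σ i h = v i := by
  have hp : (List.ofFn (fun i : Fin n => v ((π n).symm i))).Pairwise lt := by
    rw [List.pairwise_ofFn]
    intro i j hij
    apply hv _ _ (Fin.is_lt _) (Fin.is_lt _)
    · rw [← hπ n]
      simpa using hij.le
    · intro h
      have := (π n).symm.injective (Fin.ext h)
      exact hij.ne this
  refine ⟨⟨_, List.isChain_iff_pairwise.2 hp⟩, by simp, ?_⟩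
  intro i h
  have hi : i < n := by simpa using h
  simp only [rd, List.get_eq_getElem, List.getElem_ofFn]
  congr 1
  have : ∀ (a : Fin n), (a : ℕ) = (π n ⟨i, hi⟩ : ℕ) → (((π n).symm a : Fin n) : ℕ) = i := by
    intro a ha
    rw [Fin.ext ha]; simp
  apply this
  exact perm_cast π (by simp) i _ _

theorem step {α : Type} {lt : α → α → Prop} (hlt : IsStrictTotalOrder α lt)
    {π : ∀ n, Equiv.Perm (Fin n)} {σ τ : IncList lt} (h : DLt lt π σ τ) (n : ℕ)
    (hs : n ≤ σ.1.length) (ht : n ≤ τ.1.length)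
    (hag : ∀ i, i < n → ∀ h1 h2, rd π σ i h1 = rd π τ i h2) :
    n < τ.1.length ∧ ∀ h1 h2, lt (rd π σ n h1) (rd π τ n h2) ∨ rd π σ n h1 = rd π τ n h2 := by
  rcases h with ⟨j, js, jt, hj, heq⟩ | ⟨hlen, heq⟩
  · have hnj : n ≤ j := by
      by_contra hc
      have := hag j (by omega) js jt
      unfold rd at this
      rw [this] at hj
      exact irrefl_of lt _ hj
    refine ⟨by omega, fun h1 h2 => ?_⟩
    rcases hnj.eq_or_lt with rfl | hlt'
    · exact Or.inl hj
    · exact Or.inr (heq n h1 h2 hlt')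
  · exact ⟨by omega, fun h1 h2 => Or.inr (heq n h1 h2)⟩

theorem stab {α : Type} {lt : α → α → Prop} (hlt : IsStrictTotalOrder α lt)
    (hwf : WellFounded lt) {π : ∀ n, Equiv.Perm (Fin n)} (f : ℕ → IncList lt)
    (hf : ∀ n, DLt lt π (f (n + 1)) (f n)) (n : ℕ) :
    ∃ (e : ℕ → α) (N : ℕ), ∀ k, N ≤ k → n ≤ (f k).1.length ∧
      ∀ i, i < n → ∀ h, rd π (f k) i h = e i := by
  induction n with
  | zero =>
    have hne : Nonempty α := by
      have := (step hlt (hf 0) 0 (by simp) (by simp) (by simp)).1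
      exact ⟨(f 0).1.get ⟨0, this⟩⟩
    exact ⟨fun _ => hne.some, 0, by simp⟩
  | succ n ih =>
    obtain ⟨e, N, hN⟩ := ih
    have hs : ∀ k, N ≤ k → _ := fun k hk => step hlt (hf k) n (hN (k+1) (by omega)).1 (hN k hk).1
      (fun i hi h1 h2 => ((hN (k+1) (by omega)).2 i hi h1).trans ((hN k hk).2 i hi h2).symm)
    let S : Set α := {a | ∃ k, N ≤ k ∧ ∃ h, rd π (f k) n h = a}
    have hS : S.Nonempty := ⟨_, N, le_rfl, (hs N le_rfl).1, rfl⟩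
    obtain ⟨K, hK, hKl, hKe⟩ := hwf.min_mem S hS
    have hmin : ∀ k, K ≤ k → ∀ h, rd π (f k) n h = hwf.min S hS := by
      intro k hk
      induction k, hk using Nat.le_induction with
      | base => intro _; exact hKe
      | succ k hk ih =>
        intro h
        have hkl := (hs k (by omega)).1
        rcases (hs k (by omega)).2 h hkl with h' | h'
        · rw [ih hkl] at h'
          exact absurd h' (hwf.not_lt_min S ⟨k+1, by omega, h, rfl⟩)
        · rw [h', ih hkl]
    refine ⟨fun i => if i = n then hwf.min S hS else e i, K, fun k hk =>
      ⟨(hs k (by omega)).1, fun i hi h => ?_⟩⟩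
    by_cases hin : i = n
    · subst hin; simpa using hmin k hk h
    · simpa [hin] using (hN k (by omega)).2 i (by omega) h

end DLaux

open DLaux in
/-- `D_L` preserves well orders if and only if `L` is ill-founded. -/
theorem stmt9 (Lle : ℕ → ℕ → Prop) (hL : IsLinearOrder ℕ Lle)
    (π : ∀ n, Equiv.Perm (Fin n)) (hπ : PermOf Lle π) :
    (∀ (α : Type) (lt : α → α → Prop), IsStrictTotalOrder α lt → WellFounded lt →
        ∀ f : ℕ → IncList lt, ¬ ∀ n, DLt lt π (f (n + 1)) (f n)) ↔
    (∃ g : ℕ → ℕ, ∀ n, Lle (g (n + 1)) (g n) ∧ g (n + 1) ≠ g n) := by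
  constructor
  · intro H
    by_contra hg
    let r : ℕ → ℕ → Prop := fun a b => Lle a b ∧ a ≠ b
    have hr : WellFounded r := by
      rw [wellFounded_iff_isEmpty_descending_chain]
      exact ⟨fun g => hg ⟨g.1, g.2⟩⟩
    let lt : ℕ × ℕ → ℕ × ℕ → Prop := Prod.Lex r (· < ·)
    have hwf : WellFounded lt := WellFounded.prod_lex hr wellFounded_lt
    have rst : IsStrictTotalOrder ℕ r :=
      { irrefl := fun a h => h.2 rfl
        trans := fun a b c h1 h2 => ⟨_root_.trans_of Lle h1.1 h2.1, by
          rintro rfl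
          exact h1.2 (antisymm_of Lle h1.1 h2.1)⟩
        trichotomous := fun a b h1 h2 => by
          by_contra hne
          rcases total_of Lle a b with h | h
          · exact h1 ⟨h, hne⟩
          · exact h2 ⟨h, Ne.symm hne⟩ }
    have hst : IsStrictTotalOrder (ℕ × ℕ) lt := 
      { irrefl := fun a h => hwf.irrefl.irrefl a h
        trans := fun a b c h1 h2 => _root_.trans_of (Prod.Lex r (· < ·)) h1 h2
        trichotomous := fun a b h1 h2 => by
          rcases trichotomous_of r a.1 b.1 with h | h | h
          · exact absurd (Prod.lex_def.2 (Or.inl h)) h1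
          · rcases lt_trichotomy a.2 b.2 with h' | h' | h'
            · exact absurd (Prod.lex_def.2 (Or.inr ⟨h, h'⟩)) h1
            · exact Prod.ext h h'
            · exact absurd (Prod.lex_def.2 (Or.inr ⟨h.symm, h'⟩)) h2
          · exact absurd (Prod.lex_def.2 (Or.inl h)) h2 }
    have key : ∀ k : ℕ, ∃ σ : IncList lt, σ.1.length = k + 1 ∧
        ∀ i h, rd π σ i h = (i, if i = k then 1 else 0) := fun k =>
      exists_inc hst hπ (k+1) (fun i => (i, if i = k then 1 else 0))
        (fun i j _ _ h hne => Prod.lex_def.2 (Or.inl ⟨h, hne⟩))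
    choose f hlen hf using key
    refine H _ lt hst hwf f fun k => Or.inl ⟨k, by rw [hlen]; omega, by rw [hlen]; omega, ?_, ?_⟩
    · have h1 := hf (k+1) k (by rw [hlen]; omega)
      have h2 := hf k k (by rw [hlen]; omega)
      unfold rd at h1 h2
      rw [h1, h2]
      exact Prod.lex_def.2 (Or.inr ⟨rfl, by simp⟩)
    · intro i h1 h2 hi
      have h1 := hf (k+1) i h1
      have h2 := hf k i h2
      unfold rd at h1 h2
      rw [h1, h2, if_neg (by omega), if_neg (by omega)]
  · rintro ⟨g, hg⟩ α lt hlt hwf f hf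
    have key : ∀ n, ∃ a N, ∀ k, N ≤ k → ∃ h, rd π (f k) n h = a := by
      intro n
      obtain ⟨e, N, h⟩ := stab hlt hwf f hf (n+1)
      exact ⟨e n, N, fun k hk => ⟨(h k hk).1, (h k hk).2 n (by omega) _⟩⟩
    choose e N he using key
    refine (wellFounded_iff_isEmpty_descending_chain.1 hwf).false ⟨fun n => e (g n), fun n => ?_⟩
    obtain ⟨h1, e1⟩ := he (g n) (max (N (g n)) (N (g (n+1)))) (le_max_left _ _)
    obtain ⟨h2, e2⟩ := he (g (n+1)) (max (N (g n)) (N (g (n+1)))) (le_max_right _ _)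
    beta_reduce
    rw [← e1, ← e2]
    exact rd_lt hlt hπ _ _ _ _ _ (hg n).1 (hg n).2
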